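/- Let (X,d) be a finite metric space that admits a dominating stochastic embedding into tree metrics with expected distortion D, and let t > 0. Then there exists an embedding f : X → ℓ1 such that: (1) ‖f(v)‖₁ = t for every v ∈ X; (2) ‖f(v) − f(u)‖₁ ≤ 4·D·d(v,u) for all u,v ∈ X; and (3) ‖f(v) − f(u)‖₁ ≥ min{d(v,u), t} for all u,v ∈ X. -/

import Mathlib

noncomputable section

open scoped BigOperators

/-- The space `ℓ₁` of absolutely summable real sequences. -/
abbrev ℓ1 : Type := lp (fun _ : ℕ => ℝ) 1

/-- The weight of a walk: the sum of the weights of its edges. -/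
def walkWeight {V : Type*} {G : SimpleGraph V} (w : V → V → ℝ)
    {u v : V} (p : G.Walk u v) : ℝ :=
  (p.darts.map fun d => w d.toProd.1 d.toProd.2).sum

/-- The shortest-path distance between `u` and `v` in the graph `G`
with edge weights `w`. -/
def wdist {V : Type*} (G : SimpleGraph V) (w : V → V → ℝ) (u v : V) : ℝ :=
  sInf {x | ∃ p : G.Walk u v, walkWeight w p = x}

/-- A connected weighted graph with positive symmetric edge weights. -/
structure WeightedGraph (V : Type*) where
  G : SimpleGraph V
  conn : G.Connected
  w : V → V → ℝ
  w_symm : ∀ u v, w u v = w v u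
  w_pos : ∀ u v, G.Adj u v → 0 < w u v

/-- The shortest-path metric of a weighted graph. -/
def WeightedGraph.dist {V : Type*} (W : WeightedGraph V) (u v : V) : ℝ :=
  wdist W.G W.w u v

/-- `ρ` is a tree metric on `X`: there is a finite weighted tree containing (a copy of)
`X` among its vertices whose shortest-path metric restricts to `ρ` on `X`. -/
def IsTreeMetric {X : Type} (ρ : X → X → ℝ) : Prop :=
  ∃ (V : Type) (_ : Fintype V) (W : WeightedGraph V), W.G.IsTree ∧
    ∃ j : X → V, Function.Injective j ∧ ∀ u v : X, ρ u v = W.dist (j u) (j v)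


variable {V : Type} in
theorem walkWeight_nonneg' (W : WeightedGraph V) {u v : V} (p : W.G.Walk u v) :
    0 ≤ walkWeight W.w p := by
  induction p with
  | nil => simp [walkWeight]
  | cons h p ih =>
    have := W.w_pos _ _ h
    simp only [walkWeight, SimpleGraph.Walk.darts_cons, List.map_cons, List.sum_cons] at ih ⊢
    linarith

theorem walkWeight_cons' {V : Type} {G : SimpleGraph V} (w : V → V → ℝ) {u x v : V}
    (h : G.Adj u x) (p : G.Walk x v) :
    walkWeight w (SimpleGraph.Walk.cons h p) = w u x + walkWeight w p := by
  simp [walkWeight]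

theorem walkWeight_append' {V : Type} {G : SimpleGraph V} (w : V → V → ℝ) {u x v : V}
    (p : G.Walk u x) (q : G.Walk x v) :
    walkWeight w (p.append q) = walkWeight w p + walkWeight w q := by
  simp [walkWeight]

theorem walkWeight_reverse' {V : Type} (W : WeightedGraph V) {u v : V}
    (p : W.G.Walk u v) : walkWeight W.w p.reverse = walkWeight W.w p := by
  induction p with
  | nil => simp [walkWeight]
  | cons h p ih =>
    rw [SimpleGraph.Walk.reverse_cons, walkWeight_append', ih, walkWeight_cons',
      walkWeight_cons', W.w_symm]
    simp [walkWeight]; ring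

open Classical in
theorem walkWeight_bypass' {V : Type} (W : WeightedGraph V) {u v : V}
    (p : W.G.Walk u v) : walkWeight W.w p.bypass ≤ walkWeight W.w p := by
  induction p with
  | nil => simp [walkWeight, SimpleGraph.Walk.bypass]
  | cons h p ih =>
    rename_i a b c
    rw [walkWeight_cons']
    have hw := W.w_pos _ _ h
    simp only [SimpleGraph.Walk.bypass]
    split_ifs with hs
    · have h1 := congrArg (walkWeight W.w) (p.bypass.take_spec hs)
      rw [walkWeight_append'] at h1
      have := walkWeight_nonneg' W (p.bypass.takeUntil _ hs)
      linarith
    · rw [walkWeight_cons']; linarith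

theorem dist_eq_path {V : Type} (W : WeightedGraph V) (hT : W.G.IsTree) {u v : V}
    (p : W.G.Walk u v) (hp : p.IsPath) : W.dist u v = walkWeight W.w p := by
  classical
  unfold WeightedGraph.dist wdist
  apply IsLeast.csInf_eq
  refine ⟨⟨p, rfl⟩, ?_⟩
  rintro _ ⟨q, rfl⟩
  have : p = q.bypass := (hT.existsUnique_path u v).unique hp q.bypass_isPath
  rw [this]
  exact walkWeight_bypass' W q

set_option maxHeartbeats 1600000 in
theorem tree_embed {V : Type} [Fintype V] (W : WeightedGraph V) (hT : W.G.IsTree)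
    (t : ℝ) (ht : 0 < t) :
    ∃ g : V → V → ℝ, (∀ v, ∑ x, |g v x| = t) ∧
      (∀ u v, ∑ x, |g v x - g u x| ≤ 2 * W.dist v u) ∧
      (∀ u v, min (W.dist v u) t ≤ ∑ x, |g v x - g u x|) := by
  classical
  obtain ⟨r⟩ := hT.connected.nonempty
  choose P hP using fun v => (hT.existsUnique_path v r).exists
  have hPu : ∀ v (q : W.G.Walk v r), q.IsPath → P v = q := fun v q hq =>
    (hT.existsUnique_path v r).unique (hP v) hq
  set h : V → ℝ := fun v => walkWeight W.w (P v) with hh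
  have h0 : ∀ v, 0 ≤ h v := fun v => walkWeight_nonneg' W _
  set A : V → Finset V := fun v => (P v).support.toFinset with hA
  have hPr : P r = SimpleGraph.Walk.nil := hPu r _ SimpleGraph.Walk.IsPath.nil
  have hr0 : h r = 0 := by simp [hh, hPr, walkWeight]
  have hAr : A r = {r} := by simp [hA, hPr]
  set q : V → ℝ := fun x => if x = r then -t else h (P x).snd with hq
  set F : ℝ → V → ℝ := fun s x => max 0 (h x - max (q x) s) with hF
  have hF0 : ∀ s x, 0 ≤ F s x := fun s x => le_max_left _ _
  -- one step towards the root
  have step : ∀ u x (a : W.G.Adj u x) (p : W.G.Walk x r), (SimpleGraph.Walk.cons a p).IsPath →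
      u ≠ r ∧ h u = W.w u x + h x ∧ A u = insert u (A x) ∧ u ∉ A x ∧ q u = h x := by
    intro u x a p hp
    have h1 := hPu u _ hp
    rw [SimpleGraph.Walk.cons_isPath_iff] at hp
    have h2 := hPu x _ hp.1
    have hur : u ≠ r := by
      rintro rfl
      exact hp.2 p.end_mem_support
    refine ⟨hur, ?_, ?_, ?_, ?_⟩
    · simp [hh, h1, h2, walkWeight_cons']
    · simp [hA, h1, h2]
    · simpa [hA, h2] using hp.2
    · simp [hq, hur, h1]
  have tele : ∀ s, -t ≤ s → ∀ v (p : W.G.Walk v r), p.IsPath →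
      ∑ x ∈ A v, F s x = max 0 (h v - s) := by
    intro s hs
    suffices ∀ v r' (p : W.G.Walk v r'), (e : r' = r) → p.IsPath →
      ∑ x ∈ A v, F s x = max 0 (h v - s) from fun v p hp => this v r p rfl hp
    intro v r' p
    induction p with
    | nil =>
      rintro rfl _
      rw [hAr]; simp [hF, hq, hr0, hs]
    | cons a p ih =>
      rintro rfl hp
      obtain ⟨h1, h2, h3, h4, h5⟩ := step _ _ a p hp
      rw [h3, Finset.sum_insert h4, ih rfl ((SimpleGraph.Walk.cons_isPath_iff _ _).1 hp).1]
      have := W.w_pos _ _ a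
      simp only [hF, h5]
      grind
  have lca : ∀ v u (p : W.G.Walk u r), p.IsPath →
      ∃ l, A u ∩ A v = A l ∧ h l ≤ h u ∧ h l ≤ h v ∧ ∃ π : W.G.Walk u v, π.IsPath ∧
        (∀ y ∈ π.support, y ∈ A u ∪ A v) ∧ walkWeight W.w π = h u + h v - 2 * h l := by
    intro v
    have case1 : ∀ u, u ∈ A v → 
      ∃ l, A u ∩ A v = A l ∧ h l ≤ h u ∧ h l ≤ h v ∧ ∃ π : W.G.Walk u v, π.IsPath ∧
        (∀ y ∈ π.support, y ∈ A u ∪ A v) ∧ walkWeight W.w π = h u + h v - 2 * h l := by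
      intro u hu
      have hu' : u ∈ (P v).support := by simpa [hA] using hu
      have hd := hPu u _ ((hP v).dropUntil hu')
      have hsub : A u ⊆ A v := by
        intro y hy
        simp only [hA, List.mem_toFinset, hd] at hy ⊢
        exact (P v).support_dropUntil_subset_support hu' hy
      have hw : h v = walkWeight W.w ((P v).takeUntil u hu') + h u := by
        have h1 := congrArg (walkWeight W.w) ((P v).take_spec hu')
        rw [walkWeight_append', ← hd] at h1
        exact h1.symm
      have hn := walkWeight_nonneg' W ((P v).takeUntil u hu')
      refine ⟨u, Finset.inter_eq_left.2 hsub, le_rfl, by linarith,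
        ((P v).takeUntil u hu').reverse, ((hP v).takeUntil hu').reverse, ?_, ?_⟩
      · intro y hy
        rw [SimpleGraph.Walk.support_reverse, List.mem_reverse] at hy
        refine Finset.mem_union_right _ ?_
        simp only [hA, List.mem_toFinset]
        exact (P v).support_takeUntil_subset_support hu' hy
      · rw [walkWeight_reverse']; linarith
    suffices ∀ u r' (p : W.G.Walk u r'), (e : r' = r) → p.IsPath → 
      ∃ l, A u ∩ A v = A l ∧ h l ≤ h u ∧ h l ≤ h v ∧ ∃ π : W.G.Walk u v, π.IsPath ∧
        (∀ y ∈ π.support, y ∈ A u ∪ A v) ∧ walkWeight W.w π = h u + h v - 2 * h l from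
      fun u p hp => this u r p rfl hp
    intro u r' p
    induction p with
    | nil =>
      rintro rfl _
      exact case1 _ (by simp [hA])
    | cons a p ih =>
      rename_i u x _
      rintro rfl hp
      by_cases hu : u ∈ A v
      · exact case1 _ hu
      obtain ⟨h1, h2, h3, h4, h5⟩ := step _ _ a p hp
      obtain ⟨l, hl1, hl2, hl3, π, hπ, hπs, hπw⟩ :=
        ih rfl ((SimpleGraph.Walk.cons_isPath_iff _ _).1 hp).1
      have := W.w_pos _ _ a
      refine ⟨l, ?_, by linarith, hl3, SimpleGraph.Walk.cons a π, ?_, ?_, ?_⟩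
      · rw [h3, Finset.insert_inter_of_notMem hu, hl1]
      · rw [SimpleGraph.Walk.cons_isPath_iff]
        refine ⟨hπ, fun hy => ?_⟩
        have := hπs _ hy
        simp only [Finset.mem_union] at this
        tauto
      · intro y hy
        rw [SimpleGraph.Walk.support_cons, List.mem_cons] at hy
        rw [h3]
        rcases hy with rfl | hy
        · simp
        · have := hπs _ hy
          simp only [Finset.mem_union, Finset.mem_insert] at this ⊢
          tauto
      · rw [walkWeight_cons', hπw, h2]; ring
  have tele' : ∀ s, -t ≤ s → ∀ v, ∑ x ∈ A v, F s x = max 0 (h v - s) :=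
    fun s hs v => tele s hs v (P v) (hP v)
  have hs : ∀ v, -t ≤ h v - t := fun v => by linarith [h0 v]
  refine ⟨fun v x => if x ∈ A v then F (h v - t) x else 0, ?_, ?_⟩
  · intro v
    have : ∀ x, |if x ∈ A v then F (h v - t) x else 0| = if x ∈ A v then F (h v - t) x else 0 := by
      intro x
      apply abs_of_nonneg
      split_ifs
      · exact hF0 _ _
      · exact le_rfl
    simp only [this]
    rw [Finset.sum_ite_mem, Finset.univ_inter, tele' _ (hs v)]
    simp [ht.le]
  have key : ∀ u v, ∃ a b : ℝ, 0 ≤ a ∧ 0 ≤ b ∧ W.dist v u = a + b ∧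
      ∑ x, |(if x ∈ A v then F (h v - t) x else 0) - (if x ∈ A u then F (h u - t) x else 0)| =
        2 * min t (max a b) := by
    intro u v
    obtain ⟨l, hl1, hl2, hl3, π, hπ, -, hπw⟩ := lca u v (P v) (hP v)
    refine ⟨h v - h l, h u - h l, by linarith, by linarith, ?_, ?_⟩
    · rw [dist_eq_path W hT π hπ, hπw]; ring
    have hlv : A l ⊆ A v := hl1 ▸ Finset.inter_subset_left
    have hlu : A l ⊆ A u := hl1 ▸ Finset.inter_subset_right
    -- pointwise decomposition
    have hpt : ∀ x, |(if x ∈ A v then F (h v - t) x else 0) -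
        (if x ∈ A u then F (h u - t) x else 0)| =
        ((if x ∈ A v then F (h v - t) x else 0) - (if x ∈ A l then F (h v - t) x else 0)) +
        ((if x ∈ A u then F (h u - t) x else 0) - (if x ∈ A l then F (h u - t) x else 0)) +
        (if x ∈ A l then |F (h v - t) x - F (h u - t) x| else 0) := by
      intro x
      have hx : x ∈ A l ↔ x ∈ A v ∧ x ∈ A u := by rw [← hl1, Finset.mem_inter]
      have e1 := abs_of_nonneg (hF0 (h v - t) x)
      have e2 := abs_of_nonneg (hF0 (h u - t) x)
      by_cases c1 : x ∈ A v <;> by_cases c2 : x ∈ A u <;> simp [hx, c1, c2, e1, e2]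
    have habs : ∑ x ∈ A l, |F (h v - t) x - F (h u - t) x| =
        |max 0 (h l - (h v - t)) - max 0 (h l - (h u - t))| := by
      rw [← tele' _ (hs v), ← tele' _ (hs u), ← Finset.sum_sub_distrib]
      rcases le_total (h v) (h u) with c | c
      · have : ∀ x, 0 ≤ F (h v - t) x - F (h u - t) x := by
          intro x; simp only [hF]; grind
        rw [abs_of_nonneg (Finset.sum_nonneg fun x _ => this x)]
        exact Finset.sum_congr rfl fun x _ => abs_of_nonneg (this x)
      · have : ∀ x, F (h v - t) x - F (h u - t) x ≤ 0 := by
          intro x; simp only [hF]; grind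
        rw [abs_of_nonpos (Finset.sum_nonpos fun x _ => this x), ← Finset.sum_neg_distrib]
        exact Finset.sum_congr rfl fun x _ => abs_of_nonpos (this x)
    simp only [hpt, Finset.sum_add_distrib, Finset.sum_sub_distrib, Finset.sum_ite_mem,
      Finset.univ_inter, tele' _ (hs v), tele' _ (hs u), habs]
    grind
  constructor
  · intro u v
    obtain ⟨a, b, ha, hb, hd, hsum⟩ := key u v
    rw [hd, hsum]; grind
  · intro u v
    obtain ⟨a, b, ha, hb, hd, hsum⟩ := key u v
    rw [hd, hsum]; grind

theorem fin_to_l1 (κ : Type) [Fintype κ] : ∃ E : (κ → ℝ) → ℓ1,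
    (∀ a, ‖E a‖ = ∑ k, |a k|) ∧ ∀ a b, E (a - b) = E a - E b := by
  classical
  let e := Fintype.equivFin κ
  let ext : (κ → ℝ) → ℕ → ℝ := fun a n =>
    if hn : n < Fintype.card κ then a (e.symm ⟨n, hn⟩) else 0
  refine ⟨fun a => ∑ n ∈ Finset.range (Fintype.card κ), lp.single 1 n (ext a n), ?_, ?_⟩
  · intro a
    have := lp.norm_sum_single (E := fun _ : ℕ => ℝ) (p := 1) (by simp) (ext a)
      (Finset.range (Fintype.card κ))
    simp only [ENNReal.toReal_one, Real.rpow_one] at this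
    rw [this, Finset.sum_range, ← e.symm.sum_comp]
    apply Finset.sum_congr rfl
    intro k _
    simp [ext]
  · intro a b
    simp only
    rw [← Finset.sum_sub_distrib]
    apply Finset.sum_congr rfl
    intro n _
    rw [← lp.single_sub]
    congr 1
    simp only [ext]
    split_ifs <;> simp

/-- If a finite metric space `(X, d)` admits a dominating stochastic embedding into tree
metrics with expected distortion `D` (a finitely supported distribution, index type `ι`
with probabilities `p`, over dominating tree metrics `ρ i` with `E[ρ(u,v)] ≤ D·d(u,v)`),
then for every `t > 0` there is an embedding `f : X → ℓ₁` with `‖f v‖ = t` for every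
`v`, which is `4D`-Lipschitz and satisfies `‖f v - f u‖ ≥ min {d(v,u), t}`. -/
theorem truncated_embedding_of_tree_embedding (X : Type) [Fintype X] [MetricSpace X]
    (D : ℝ) (ι : Type) [Fintype ι] (p : ι → ℝ) (ρ : ι → X → X → ℝ)
    (hp : ∀ i, 0 ≤ p i) (hp1 : ∑ i, p i = 1)
    (htree : ∀ i, p i ≠ 0 → IsTreeMetric (ρ i))
    (hdom : ∀ i, p i ≠ 0 → ∀ u v : X, dist u v ≤ ρ i u v)
    (hexp : ∀ u v : X, ∑ i, p i * ρ i u v ≤ D * dist u v)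
    (t : ℝ) (ht : 0 < t) :
    ∃ f : X → ℓ1,
      (∀ v : X, ‖f v‖ = t) ∧
      (∀ u v : X, ‖f v - f u‖ ≤ 4 * D * dist v u) ∧
      (∀ u v : X, min (dist v u) t ≤ ‖f v - f u‖) := by
  classical
  have hex : ∀ i, ∃ (V : Type) (_ : Fintype V) (g : X → V → ℝ), p i ≠ 0 →
      (∀ v, ∑ x, |g v x| = t) ∧ (∀ u v, ∑ x, |g v x - g u x| ≤ 2 * ρ i v u) ∧
      (∀ u v, min (ρ i v u) t ≤ ∑ x, |g v x - g u x|) := by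
    intro i
    by_cases hi : p i = 0
    · exact ⟨Unit, inferInstance, fun _ _ => 0, fun h => absurd hi h⟩
    obtain ⟨V, hV, W, hT, j, -, hj⟩ := htree i hi
    obtain ⟨g, h1, h2, h3⟩ := tree_embed W hT t ht
    refine ⟨V, hV, fun x => g (j x), fun _ => ⟨fun v => h1 _, fun u v => ?_, fun u v => ?_⟩⟩
    · rw [hj]; exact h2 _ _
    · rw [hj]; exact h3 _ _
  choose V hV g hg using hex
  obtain ⟨E, hE1, hE2⟩ := fin_to_l1 (Σ i, V i)
  let G : X → (Σ i, V i) → ℝ := fun v k => p k.1 * g k.1 v k.2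
  have hn : ∀ u v, ‖E (G v) - E (G u)‖ = ∑ i, p i * ∑ x, |g i v x - g i u x| := by
    intro u v
    rw [← hE2, hE1, Fintype.sum_sigma]
    refine Finset.sum_congr rfl fun i _ => ?_
    rw [Finset.mul_sum]
    refine Finset.sum_congr rfl fun x _ => ?_
    simp only [G, Pi.sub_apply]
    rw [← mul_sub, abs_mul, abs_of_nonneg (hp i)]
  refine ⟨fun v => E (G v), ?_, ?_, ?_⟩
  · intro v
    rw [hE1, Fintype.sum_sigma]
    have : ∀ i, ∑ x, |G v ⟨i, x⟩| = p i * t := by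
      intro i
      by_cases hi : p i = 0
      · simp [G, hi]
      rw [← (hg i hi).1 v, Finset.mul_sum]
      refine Finset.sum_congr rfl fun x _ => ?_
      simp only [G]
      rw [abs_mul, abs_of_nonneg (hp i)]
    simp only [this]
    rw [← Finset.sum_mul, hp1, one_mul]
  · intro u v
    simp only [hn]
    have h1 : ∑ i, p i * ∑ x, |g i v x - g i u x| ≤ 2 * ∑ i, p i * ρ i v u := by
      rw [Finset.mul_sum]
      refine Finset.sum_le_sum fun i _ => ?_
      by_cases hi : p i = 0
      · simp [hi]
      have := mul_le_mul_of_nonneg_left ((hg i hi).2.1 u v) (hp i)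
      linarith
    have h2 : 0 ≤ ∑ i, p i * ρ i v u := by
      refine Finset.sum_nonneg fun i _ => ?_
      by_cases hi : p i = 0
      · simp [hi]
      exact mul_nonneg (hp i) (dist_nonneg.trans (hdom i hi v u))
    linarith [hexp v u]
  · intro u v
    simp only [hn]
    calc min (dist v u) t = ∑ i, p i * min (dist v u) t := by
          rw [← Finset.sum_mul, hp1, one_mul]
      _ ≤ _ := by
        refine Finset.sum_le_sum fun i _ => ?_
        by_cases hi : p i = 0
        · simp [hi]
        refine mul_le_mul_of_nonneg_left (le_trans ?_ ((hg i hi).2.2 u v)) (hp i)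
        exact min_le_min_right _ (hdom i hi v u)
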